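/- Let L be a C^k (k ≥ 2) Tonelli Lagrangian on T𝕋ⁿ without conjugate points, with Euler–Lagrange flow (φ_t). Fix T > 0 and r ∈ ℤⁿ. For each x ∈ ℝⁿ there is a unique vector X(x) ∈ ℝⁿ such that the first component of φ_T(x, X(x)) equals x + r; the map X : ℝⁿ → ℝⁿ so defined satisfies X(x+m) = X(x) for all m ∈ ℤⁿ and is of class C^{k−1}. -/

import Mathlib

open MeasureTheory
open scoped NNReal

noncomputable section

abbrev E (n : ℕ) : Type := Fin n → ℝ

/-- The vector of `ℝⁿ` whose coordinates are the integers `m i`. -/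
def intVec {n : ℕ} (m : Fin n → ℤ) : E n := fun i => (m i : ℝ)

/-- A Tonelli Lagrangian on `T𝕋ⁿ`, identified with a `ℤⁿ`-periodic (in `x`) function
on `ℝⁿ × ℝⁿ` which is `Cᵏ`, uniformly superlinear in `v` and with positive definite
fiberwise Hessian. -/
structure IsTonelliLagrangian (n : ℕ) (k : ℕ∞) (L : E n × E n → ℝ) : Prop where
  smooth : ContDiff ℝ k L
  periodic : ∀ (x v : E n) (m : Fin n → ℤ), L (x + intVec m, v) = L (x, v)
  superlinear : ∀ C : ℝ, ∃ R : ℝ, ∀ (x v : E n), R ≤ ‖v‖ → C * ‖v‖ ≤ L (x, v)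
  posdef : ∀ (x v w : E n), w ≠ 0 →
    0 < fderiv ℝ (fun v' => fderiv ℝ (fun v'' => L (x, v'')) v' w) v w

/-- Partial differential of `L` in the fiber (velocity) direction. -/
def partialV (n : ℕ) (L : E n × E n → ℝ) (x v : E n) : E n →L[ℝ] ℝ :=
  fderiv ℝ (fun v' => L (x, v')) v

/-- Partial differential of `L` in the base (position) direction. -/
def partialX (n : ℕ) (L : E n × E n → ℝ) (x v : E n) : E n →L[ℝ] ℝ :=
  fderiv ℝ (fun x' => L (x', v)) x

/-- A `C²` curve satisfying the Euler–Lagrange equation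
`d/dt (∂L/∂v(γ, γ')) = ∂L/∂x(γ, γ')`. -/
def IsExtremal (n : ℕ) (L : E n × E n → ℝ) (γ : ℝ → E n) : Prop :=
  ContDiff ℝ 2 γ ∧
  ∀ t : ℝ, HasDerivAt (fun s => partialV n L (γ s) (deriv γ s))
    (partialX n L (γ t) (deriv γ t)) t

/-- `φ` is the (complete, `C^{k-1}`) Euler–Lagrange flow of `L` on `ℝⁿ × ℝⁿ`:
`φ t (x,v) = (γ t, γ' t)` where `γ` is the extremal curve with `(γ 0, γ' 0) = (x, v)`. -/
def IsELFlow (n : ℕ) (k : ℕ) (L : E n × E n → ℝ)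
    (φ : ℝ → E n × E n → E n × E n) : Prop :=
  ContDiff ℝ ((k - 1 : ℕ) : ℕ∞) (fun p : ℝ × (E n × E n) => φ p.1 p.2) ∧
  (∀ z : E n × E n, φ 0 z = z) ∧
  ∀ x v : E n, IsExtremal n L (fun t => (φ t (x, v)).1) ∧
    ∀ t : ℝ, (φ t (x, v)).2 = deriv (fun s => (φ s (x, v)).1) t

/-- The flow `φ` has no conjugate points: for `t ≠ 0` the image of the vertical
subspace `{0} × ℝⁿ` under `Dφ_t(z)` meets `{0} × ℝⁿ` only in `0`. -/
def NoConjugatePoints (n : ℕ) (φ : ℝ → E n × E n → E n × E n) : Prop :=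
  ∀ (z : E n × E n) (t : ℝ), t ≠ 0 → ∀ w : E n,
    (fderiv ℝ (φ t) z (0, w)).1 = 0 → w = 0

/-- The absolutely continuous curve starting at `x` with derivative `g`. -/
def curveOf (n : ℕ) (x : E n) (g : ℝ → E n) : ℝ → E n :=
  fun s => x + ∫ u in (0:ℝ)..s, g u

/-- `Acost n L t x y` = the infimum of the Lagrangian action over all absolutely
continuous curves `c : [0,t] → ℝⁿ` with `c 0 = x` and `c t = y`. -/
def Acost (n : ℕ) (L : E n × E n → ℝ) (t : ℝ) (x y : E n) : ℝ :=
  sInf { A : ℝ | ∃ g : ℝ → E n,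
    IntervalIntegrable g volume 0 t ∧
    curveOf n x g t = y ∧
    IntervalIntegrable (fun s => L (curveOf n x g s, g s)) volume 0 t ∧
    A = ∫ s in (0:ℝ)..t, L (curveOf n x g s, g s) }

section Covering
open Set Filter Topology

variable {V : Type*} [NormedAddCommGroup V] [NormedSpace ℝ V] [FiniteDimensional ℝ V]

/-- An injective continuous linear endomorphism of a finite-dimensional space is an
equivalence. -/
lemma exists_continuousLinearEquiv_of_injective {W : Type*} [NormedAddCommGroup W]
    [NormedSpace ℝ W] [FiniteDimensional ℝ W] (A : W →L[ℝ] W) (hA : ∀ w, A w = 0 → w = 0) :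
    ∃ e : W ≃L[ℝ] W, (e : W →L[ℝ] W) = A := by
  have hinj : Function.Injective (A : W →ₗ[ℝ] W) :=
    (injective_iff_map_eq_zero (A : W →ₗ[ℝ] W)).2 hA
  refine ⟨(LinearEquiv.ofInjectiveEndo (A : W →ₗ[ℝ] W) hinj).toContinuousLinearEquiv, ?_⟩
  ext w
  rfl

/-- The map `(a, v) ↦ (a, F (a, v))` is a local diffeomorphism when the partial derivative of `F`
in its second argument is injective. -/
lemma exists_openPartialHomeomorph_graph {P : Type*} [NormedAddCommGroup P] [NormedSpace ℝ P]
    [FiniteDimensional ℝ P] {F : P × V → V} (hF : ContDiff ℝ 1 F)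
    (z : P × V) (hinj : ∀ w : V, fderiv ℝ F z (0, w) = 0 → w = 0) :
    ∃ (e : OpenPartialHomeomorph (P × V) (P × V)) (e' : (P × V) ≃L[ℝ] (P × V)),
      z ∈ e.source ∧ (∀ y, e y = (y.1, F y)) ∧ HasFDerivAt e (e' : P × V →L[ℝ] P × V) z := by
  have hp : ContDiff ℝ 1 (fun y : P × V => (y.1, F y)) := contDiff_fst.prodMk hF
  have hd : HasFDerivAt (fun y : P × V => (y.1, F y))
      ((ContinuousLinearMap.fst ℝ P V).prod (fderiv ℝ F z)) z :=
    hasFDerivAt_fst.prodMk (hF.differentiable one_ne_zero z).hasFDerivAt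
  obtain ⟨e', he'⟩ := exists_continuousLinearEquiv_of_injective
    ((ContinuousLinearMap.fst ℝ P V).prod (fderiv ℝ F z)) (by
      rintro ⟨a, w⟩ h
      have h1 : a = 0 := congrArg Prod.fst h
      have h2 : fderiv ℝ F z (a, w) = 0 := congrArg Prod.snd h
      subst h1
      simp [hinj w h2])
  rw [← he'] at hd
  exact ⟨hp.contDiffAt.toOpenPartialHomeomorph _ hd one_ne_zero, e',
    hp.contDiffAt.mem_toOpenPartialHomeomorph_source hd one_ne_zero, fun y => rfl, hd⟩

/-- A continuous lift of a differentiable curve is differentiable. -/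
lemma differentiableAt_of_lift {F : ℝ × V → V} (hF : ContDiff ℝ 1 F)
    (hinj : ∀ (z : ℝ × V) (w : V), fderiv ℝ F z (0, w) = 0 → w = 0)
    {c γ : ℝ → V} {t : ℝ} (hc : DifferentiableAt ℝ c t) (hγ : ContinuousAt γ t)
    (h : ∀ᶠ s in 𝓝 t, F (s, γ s) = c s) : DifferentiableAt ℝ γ t := by
  obtain ⟨e, e', hz, he, hd⟩ := exists_openPartialHomeomorph_graph hF (t, γ t) (hinj _)
  have hsrc : ∀ᶠ s in 𝓝 t, (s, γ s) ∈ e.source :=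
    (continuousAt_id.prodMk hγ).eventually (e.open_source.mem_nhds hz)
  have heq : (fun s => (e.symm (s, c s)).2) =ᶠ[𝓝 t] γ := by
    filter_upwards [hsrc, h] with s h1 h2
    have : e (s, γ s) = (s, c s) := by rw [he, h2]
    rw [← this, e.left_inv h1]
  have ht : e (t, γ t) = (t, c t) := by rw [he, h.self_of_nhds]
  have hmem : (t, c t) ∈ e.target := ht ▸ e.map_source hz
  have hsymm : e.symm (t, c t) = (t, γ t) := by rw [← ht, e.left_inv hz]
  have hds : DifferentiableAt ℝ e.symm (t, c t) :=
    (e.hasFDerivAt_symm hmem (by rw [hsymm]; exact hd)).differentiableAt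
  have : DifferentiableAt ℝ (fun s => (e.symm (s, c s)).2) t :=
    (DifferentiableAt.fun_comp' t (g := e.symm) (f := fun s => (s, c s)) hds
      (differentiableAt_id.prodMk hc)).snd
  exact this.congr_of_eventuallyEq heq.symm

/-- `γ` is a lift of `c` on `[a, s]` through `F` starting at `v`. -/
def IsLiftOn (F : ℝ × V → V) (c : ℝ → V) (a s : ℝ) (v : V) (γ : ℝ → V) : Prop :=
  ContinuousOn γ (Icc a s) ∧ γ a = v ∧ ∀ t ∈ Icc a s, F (t, γ t) = c t

/-- On a compact set of parameters, lifts exist on intervals of uniform length. -/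
lemma exists_uniform_lift {F : ℝ × V → V} (hF : ContDiff ℝ 1 F)
    (hinj : ∀ (z : ℝ × V) (w : V), fderiv ℝ F z (0, w) = 0 → w = 0)
    {c : ℝ → V} (hc : Continuous c) {K : Set (ℝ × V)} (hK : IsCompact K) :
    ∃ δ > 0, ∀ z ∈ K, F z = c z.1 → ∃ γ, IsLiftOn F c z.1 (z.1 + δ) z.2 γ := by
  refine hK.induction_on (p := fun S => ∃ δ > 0, ∀ z ∈ S, F z = c z.1 →
    ∃ γ, IsLiftOn F c z.1 (z.1 + δ) z.2 γ) ⟨1, one_pos, by simp⟩ ?_ ?_ ?_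
  · rintro s t hst ⟨δ, hδ, h⟩
    exact ⟨δ, hδ, fun z hz => h z (hst hz)⟩
  · rintro s t ⟨δ, hδ, h⟩ ⟨ε, hε, h'⟩
    have key : ∀ z : ℝ × V, ∀ r ≥ min δ ε, (∃ γ, IsLiftOn F c z.1 (z.1 + r) z.2 γ) →
        ∃ γ, IsLiftOn F c z.1 (z.1 + min δ ε) z.2 γ := by
      rintro z r hr ⟨γ, h1, h2, h3⟩
      have hsub : Icc z.1 (z.1 + min δ ε) ⊆ Icc z.1 (z.1 + r) :=
        Icc_subset_Icc_right (by linarith)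
      exact ⟨γ, h1.mono hsub, h2, fun t ht => h3 t (hsub ht)⟩
    refine ⟨min δ ε, lt_min hδ hε, fun z hz hzF => ?_⟩
    rcases hz with hz | hz
    · exact key z δ (min_le_left _ _) (h z hz hzF)
    · exact key z ε (min_le_right _ _) (h' z hz hzF)
  · intro z _
    by_cases hzF : F z = c z.1
    · obtain ⟨e, e', hz, he, -⟩ := exists_openPartialHomeomorph_graph hF z (hinj _)
      have htar : ∀ᶠ t in 𝓝 z.1, (t, c t) ∈ e.target := by
        have : (z.1, c z.1) ∈ e.target := by
          rw [← hzF, ← he]; exact e.map_source hz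
        exact (continuousAt_id.prodMk hc.continuousAt).eventually (e.open_target.mem_nhds this)
      obtain ⟨δ, hδ, hball⟩ := Metric.eventually_nhds_iff_ball.1 htar
      refine ⟨_, mem_nhdsWithin_of_mem_nhds (inter_mem (e.open_source.mem_nhds hz)
        (continuousAt_fst.preimage_mem_nhds (Metric.ball_mem_nhds z.1 (half_pos hδ)))),
        δ / 4, by positivity, ?_⟩
      rintro y ⟨hy1, hy2⟩ hyF
      have hmem : ∀ t ∈ Icc y.1 (y.1 + δ / 4), (t, c t) ∈ e.target := by
        intro t ht
        apply hball
        rw [mem_preimage, Metric.mem_ball, Real.dist_eq, abs_lt] at hy2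
        rw [Metric.mem_ball, Real.dist_eq, abs_lt]
        constructor <;> linarith [ht.1, ht.2, hy2.1, hy2.2]
      refine ⟨fun t => (e.symm (t, c t)).2, ?_, ?_, ?_⟩
      · exact continuous_snd.comp_continuousOn (e.continuousOn_symm.comp
          (continuous_id.prodMk hc).continuousOn hmem)
      · have : e y = (y.1, c y.1) := by rw [he, hyF]
        simp only [← this, e.left_inv hy1]
      · intro t ht
        have h1 := e.right_inv (hmem t ht)
        rw [he] at h1
        have h2 : (e.symm (t, c t)).1 = t := congrArg Prod.fst h1
        have h3 : F (e.symm (t, c t)) = c t := congrArg Prod.snd h1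
        have : (t, (e.symm (t, c t)).2) = e.symm (t, c t) := Prod.ext h2.symm rfl
        rw [this, h3]
    · have : ∀ᶠ y in 𝓝 z, F y ≠ c y.1 :=
        hF.continuous.continuousAt.ne_iff_eventually_ne
          (hc.comp continuous_fst).continuousAt |>.1 hzF
      exact ⟨_, mem_nhdsWithin_of_mem_nhds this, 1, one_pos, fun y hy h => absurd h hy⟩

/-- Lifts satisfying an a priori bound exist globally. -/
lemma exists_lift_of_bound {F : ℝ × V → V} (hF : ContDiff ℝ 1 F)
    (hinj : ∀ (z : ℝ × V) (w : V), fderiv ℝ F z (0, w) = 0 → w = 0)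
    {c : ℝ → V} (hc : Continuous c) {a T R : ℝ} (haT : a ≤ T) {v : V} (hv : F (a, v) = c a)
    (hR : ∀ s ∈ Icc a T, ∀ γ, IsLiftOn F c a s v γ → ‖γ s‖ ≤ R) :
    ∃ γ, IsLiftOn F c a T v γ := by
  obtain ⟨δ, hδ, hlift⟩ := exists_uniform_lift hF hinj hc
    (K := Icc a T ×ˢ Metric.closedBall (0 : V) R)
    (isCompact_Icc.prod (isCompact_closedBall _ _))
  have key : ∀ N : ℕ, ∃ γ, IsLiftOn F c a (min T (a + N * δ)) v γ := by
    intro N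
    induction N with
    | zero =>
      refine ⟨fun _ => v, continuousOn_const, rfl, fun t ht => ?_⟩
      have : t = a := le_antisymm (by simpa [haT] using ht.2) ht.1
      rw [this, hv]
    | succ N ih =>
      obtain ⟨γ, hγ⟩ := ih
      set s := min T (a + N * δ) with hs
      have has : a ≤ s := le_min haT (by have : 0 ≤ N * δ := by positivity
                                         linarith)
      have hsT : s ≤ T := min_le_left _ _
      obtain ⟨η, h1, h2, h3⟩ := hlift (s, γ s)
        ⟨⟨has, hsT⟩, by simpa using hR s ⟨has, hsT⟩ γ hγ⟩ (hγ.2.2 s ⟨has, le_rfl⟩)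
      simp only at h1 h2 h3
      have hle : min T (a + (N + 1 : ℕ) * δ) ≤ s + δ := by
        push_cast
        rcases min_choice T (a + N * δ) with h | h
        · exact (min_le_left _ _).trans (by rw [hs, h]; linarith)
        · exact (min_le_right _ _).trans (by rw [hs, h]; linarith)
      refine ⟨fun t => if t ≤ s then γ t else η t, ?_, by simp [has, hγ.2.1], ?_⟩
      · have : ContinuousOn (fun t => if t ≤ s then γ t else η t) (Icc a (s + δ)) := by
          apply ContinuousOn.if
          · rintro t ⟨-, ht⟩
            have : t = s := by
              have := frontier_le_subset_eq continuous_id continuous_const ht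
              simpa using this
            rw [this, h2]
          · refine hγ.1.mono ?_
            rintro t ⟨ht, ht'⟩
            have : t ∈ Iic s := by
              have h : {a | a ≤ s} = Iic s := rfl
              rw [h, closure_Iic] at ht'; exact ht'
            exact ⟨ht.1, this⟩
          · refine h1.mono ?_
            rintro t ⟨ht, ht'⟩
            have : t ∈ Ici s := by
              have h : {a | ¬ a ≤ s} = Ioi s := by ext; simp
              rw [h, closure_Ioi] at ht'; exact ht'
            exact ⟨this, ht.2⟩
        exact this.mono (Icc_subset_Icc_right hle)
      · intro t ht
        by_cases hts : t ≤ s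
        · simpa [hts] using hγ.2.2 t ⟨ht.1, hts⟩
        · simpa [hts] using h3 t ⟨(not_le.1 hts).le, ht.2.trans hle⟩
  obtain ⟨N, hN⟩ := exists_nat_gt ((T - a) / δ)
  have : T ≤ a + N * δ := by
    rw [div_lt_iff₀ hδ] at hN; linarith
  simpa [min_eq_left this] using key N

/-- A `C¹` family of maps `F (t, ·)` with invertible derivatives, along which the lifts of `C¹`
curves satisfy a priori bounds, consists of bijections. -/
lemma bijective_of_lift_bound {F : ℝ × V → V} (hF : ContDiff ℝ 1 F)
    (hinj : ∀ (z : ℝ × V) (w : V), fderiv ℝ F z (0, w) = 0 → w = 0)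
    (hbd : ∀ c : ℝ → V, ContDiff ℝ 1 c → ∀ (a T : ℝ) (v : V), a ≤ T → F (a, v) = c a →
      ∃ R, ∀ s ∈ Icc a T, ∀ γ, IsLiftOn F c a s v γ → ‖γ s‖ ≤ R) (T : ℝ) :
    Function.Bijective fun v => F (T, v) := by
  have hex : ∀ c : ℝ → V, ContDiff ℝ 1 c → ∀ v, F (T - 1, v) = c (T - 1) →
      ∃ γ, IsLiftOn F c (T - 1) T v γ := by
    intro c hc v hv
    obtain ⟨R, hR⟩ := hbd c hc (T - 1) T v (by linarith) hv
    exact exists_lift_of_bound hF hinj hc.continuous (by linarith) hv hR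
  have homeo : IsLocalHomeomorph fun y : ℝ × V => (y.1, F y) := by
    refine IsLocalHomeomorph.mk _ fun z => ?_
    obtain ⟨e, -, hz, he, -⟩ := exists_openPartialHomeomorph_graph hF z (hinj z)
    exact ⟨e, hz, fun y _ => (he y).symm⟩
  have sep : IsSeparatedMap fun y : ℝ × V => (y.1, F y) := T2Space.isSeparatedMap _
  constructor
  · intro v₀ v₁ h
    set y := F (T, v₁) with hy
    have h0 : F (T, v₀) = y := h
    let vu : ℝ → V := fun u => v₀ + u • (v₁ - v₀)
    let c : ℝ → ℝ → V := fun u t => F (t, vu u) + (t - (T - 1)) • (y - F (T, vu u))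
    have hc : ∀ u, ContDiff ℝ 1 (c u) := fun u =>
      (hF.comp (contDiff_id.prodMk contDiff_const)).add
        ((contDiff_id.sub contDiff_const).smul contDiff_const)
    choose γ hγ using fun u : ℝ => hex (c u) (hc u) (vu u) (by simp [c])
    let f : C(unitInterval × unitInterval, ℝ × V) :=
      ⟨fun q => (T - 1 + q.1, c q.2 (T - 1 + q.1)), by
        have := hF.continuous
        fun_prop⟩
    let g : unitInterval × unitInterval → ℝ × V :=
      fun q => (T - 1 + q.1, γ q.2 (T - 1 + q.1))
    have hmem : ∀ s : unitInterval, T - 1 + (s : ℝ) ∈ Icc (T - 1) T := fun s =>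
      ⟨by linarith [s.2.1], by linarith [s.2.2]⟩
    have hg : (fun y : ℝ × V => (y.1, F y)) ∘ g = f := by
      ext1 q
      exact Prod.ext rfl ((hγ q.2).2.2 _ (hmem q.1))
    have hgs : ∀ u, Continuous fun s => g (s, u) := fun u =>
      (continuous_const.add continuous_subtype_val).prodMk
        ((hγ u).1.comp_continuous (continuous_const.add continuous_subtype_val) hmem)
    have hgc : Continuous g := by
      refine homeo.continuous_lift sep f hg ?_ hgs
      have : (fun u : unitInterval => g (0, u)) = fun u : unitInterval => (T - 1, vu u) := by
        ext1 u
        simp [g, (hγ u).2.1]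
      rw [this]
      fun_prop
    have hend : g (1, 0) = g (1, 1) := by
      refine sep.const_of_comp homeo.isLocallyInjective (g := fun u => g (1, u))
        (hgc.comp (by fun_prop)) (fun u u' => ?_) 0 1
      have h1 := congrFun hg (1, u)
      have h2 := congrFun hg (1, u')
      simp only [Function.comp_apply] at h1 h2
      rw [h1, h2]
      simp [f, c]
    have hconst : ∀ u : unitInterval, F (T, vu u) = y → g (1, u) = (T, vu u) := by
      intro u hu
      have := sep.eq_of_comp_eq homeo.isLocallyInjective (hgs u)
        (g₂ := fun s : unitInterval => (T - 1 + (s : ℝ), vu u)) (by fun_prop)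
        (by
          ext1 s
          have h1 := congrFun hg (s, u)
          simp only [Function.comp_apply] at h1 ⊢
          rw [h1]
          simp [f, c, hu]) 0 (by simp [g, (hγ u).2.1])
      simpa using congrFun this 1
    have e0 := hconst 0 (by simpa [vu] using h0)
    have e1 := hconst 1 (by simp [vu, hy])
    rw [e0, e1] at hend
    simpa [vu] using congrArg Prod.snd hend
  · intro y
    let y₀ := F (T - 1, (0 : V))
    obtain ⟨γ, hγ⟩ := hex (fun t => y₀ + (t - (T - 1)) • (y - y₀))
      (contDiff_const.add ((contDiff_id.sub contDiff_const).smul contDiff_const)) 0 (by simp [y₀])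
    refine ⟨γ T, ?_⟩
    have := hγ.2.2 T ⟨by linarith, le_rfl⟩
    simpa using this

end Covering

section LagrangianCalculus
open Set Filter Topology

variable {n : ℕ} {L : E n × E n → ℝ}

lemma hasFDerivAt_partialV (hL : Differentiable ℝ L) (x v : E n) :
    HasFDerivAt (fun v' => L (x, v')) (partialV n L x v) v :=
  ((hL (x, v)).comp v ((differentiableAt_const x).prodMk differentiableAt_id)).hasFDerivAt

lemma hasFDerivAt_partialX (hL : Differentiable ℝ L) (x v : E n) :
    HasFDerivAt (fun x' => L (x', v)) (partialX n L x v) x :=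
  ((hL (x, v)).comp x (differentiableAt_id.prodMk (differentiableAt_const v))).hasFDerivAt

lemma partialV_eq (hL : Differentiable ℝ L) (x v : E n) :
    partialV n L x v = (fderiv ℝ L (x, v)).comp (ContinuousLinearMap.inr ℝ (E n) (E n)) :=
  (hasFDerivAt_partialV hL x v).unique
    ((hL (x, v)).hasFDerivAt.comp v (hasFDerivAt_prodMk_right x v))

lemma partialX_eq (hL : Differentiable ℝ L) (x v : E n) :
    partialX n L x v = (fderiv ℝ L (x, v)).comp (ContinuousLinearMap.inl ℝ (E n) (E n)) :=
  (hasFDerivAt_partialX hL x v).unique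
    ((hL (x, v)).hasFDerivAt.comp x (hasFDerivAt_prodMk_left x v))

lemma fderiv_apply_eq_partials (hL : Differentiable ℝ L) (x v a b : E n) :
    fderiv ℝ L (x, v) (a, b) = partialX n L x v a + partialV n L x v b := by
  rw [partialV_eq hL, partialX_eq hL]
  simp [← map_add]

lemma continuous_partialV (hL : ContDiff ℝ 1 L) :
    Continuous fun z : E n × E n => partialV n L z.1 z.2 := by
  simp_rw [partialV_eq (hL.differentiable one_ne_zero)]
  have := hL.continuous_fderiv one_ne_zero
  exact this.clm_comp continuous_const

/-- The fiberwise Hessian of `L`, as a quadratic form. -/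
def fiberHessian (L : E n × E n → ℝ) (x v w : E n) : ℝ :=
  fderiv ℝ (fderiv ℝ L) (x, v) (0, w) (0, w)

lemma hasFDerivAt_partialV_apply (hL : ContDiff ℝ 2 L) (x v w : E n) :
    HasFDerivAt (fun v' => partialV n L x v' w)
      (((fderiv ℝ (fderiv ℝ L) (x, v)).flip (0, w)).comp
        (ContinuousLinearMap.inr ℝ (E n) (E n))) v := by
  have hd : Differentiable ℝ L := hL.differentiable two_ne_zero
  have h1 : DifferentiableAt ℝ (fderiv ℝ L) (x, v) :=
    (hL.fderiv_right (m := 1) (by norm_num)).differentiable one_ne_zero _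
  have h2 : HasFDerivAt (fun z => fderiv ℝ L z (0, w))
      ((fderiv ℝ (fderiv ℝ L) (x, v)).flip (0, w)) (x, v) := by
    have := h1.hasFDerivAt.clm_apply (hasFDerivAt_const ((0, w) : E n × E n) (x, v))
    simpa using this
  have h3 := h2.comp v (hasFDerivAt_prodMk_right x v)
  have h4 : (fun v' => partialV n L x v' w) =
      (fun z => fderiv ℝ L z (0, w)) ∘ (fun v' => (x, v')) := by
    ext v'
    simp [partialV_eq hd]
  rw [h4]
  exact h3

lemma hasDerivAt_partialV_line (hL : ContDiff ℝ 2 L) (x v w : E n) (θ : ℝ) :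
    HasDerivAt (fun θ : ℝ => partialV n L x (v + θ • w) w) (fiberHessian L x (v + θ • w) w) θ := by
  have h1 : HasDerivAt (fun θ : ℝ => v + θ • w) w θ := by
    simpa using ((hasDerivAt_id θ).smul_const w).const_add v
  have := (hasFDerivAt_partialV_apply hL x (v + θ • w) w).comp_hasDerivAt θ h1
  exact this

lemma hasDerivAt_line (hL : Differentiable ℝ L) (x v w : E n) (θ : ℝ) :
    HasDerivAt (fun θ : ℝ => L (x, v + θ • w)) (partialV n L x (v + θ • w) w) θ := by
  have h1 : HasDerivAt (fun θ : ℝ => v + θ • w) w θ := by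
    simpa using ((hasDerivAt_id θ).smul_const w).const_add v
  exact (hasFDerivAt_partialV hL x (v + θ • w)).comp_hasDerivAt θ h1

lemma continuous_fiberHessian (hL : ContDiff ℝ 2 L) :
    Continuous fun q : (E n × E n) × E n => fiberHessian L q.1.1 q.1.2 q.2 := by
  have h : Continuous (fderiv ℝ (fderiv ℝ L)) :=
    (hL.fderiv_right (m := 1) (by norm_num)).continuous_fderiv one_ne_zero
  have h2 : Continuous fun q : (E n × E n) × E n => ((0, q.2) : E n × E n) := by fun_prop
  exact ((h.comp continuous_fst).clm_apply h2).clm_apply h2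

lemma fiberHessian_smul (x v w : E n) (r : ℝ) :
    fiberHessian L x v (r • w) = r ^ 2 * fiberHessian L x v w := by
  have : ((0, r • w) : E n × E n) = r • (0, w) := by simp
  simp only [fiberHessian, this, map_smul, smul_apply, smul_eq_mul]
  ring

lemma fiberHessian_zero (x v : E n) : fiberHessian L x v 0 = 0 := by
  simpa using fiberHessian_smul (L := L) x v 0 0

variable {k : ℕ∞}

lemma IsTonelliLagrangian.contDiff_two (hL : IsTonelliLagrangian n k L) (hk : 2 ≤ k) :
    ContDiff ℝ 2 L :=
  hL.smooth.of_le (WithTop.coe_le_coe.2 hk)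

lemma IsTonelliLagrangian.fiberHessian_pos (hL : IsTonelliLagrangian n k L) (hk : 2 ≤ k)
    (x v : E n) {w : E n} (hw : w ≠ 0) : 0 < fiberHessian L x v w := by
  have h := hL.posdef x v w hw
  have h2 := (hasFDerivAt_partialV_apply (hL.contDiff_two hk) x v w).fderiv
  unfold partialV at h2
  rw [h2] at h
  simpa [fiberHessian] using h

/-- Convexity of the Lagrangian in the fibers. -/
lemma IsTonelliLagrangian.add_partialV_le (hL : IsTonelliLagrangian n k L) (hk : 2 ≤ k)
    (x v u : E n) : L (x, v) + partialV n L x v (u - v) ≤ L (x, u) := by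
  have hC := hL.contDiff_two hk
  have hd := hC.differentiable two_ne_zero
  have hmono : Monotone fun θ : ℝ => partialV n L x (v + θ • (u - v)) (u - v) := by
    refine monotone_of_hasDerivAt_nonneg (fun θ => hasDerivAt_partialV_line hC x v (u - v) θ) ?_
    intro θ
    rcases eq_or_ne (u - v) 0 with h | h
    · simp [h, fiberHessian_zero]
    · exact (hL.fiberHessian_pos hk _ _ h).le
  obtain ⟨ξ, hξ, h⟩ := exists_hasDerivAt_eq_slope (fun θ : ℝ => L (x, v + θ • (u - v))) _
    zero_lt_one (fun θ _ => (hasDerivAt_line hd x v (u - v) θ).continuousAt.continuousWithinAt)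
    (fun θ _ => hasDerivAt_line hd x v (u - v) θ)
  have := hmono hξ.1.le
  simp only [map_sub, one_smul, add_sub_cancel, zero_smul, add_zero, sub_zero, div_one] at h this ⊢
  linarith

/-- Uniform convexity of the Lagrangian in the fibers on bounded sets. -/
lemma IsTonelliLagrangian.exists_strong_convexity (hL : IsTonelliLagrangian n k L) (hk : 2 ≤ k)
    (R : ℝ) : ∃ lam > 0, ∀ x v u : E n, ‖x‖ ≤ R → ‖v‖ ≤ R → ‖u‖ ≤ R →
      lam * ‖u - v‖ ^ 2 ≤ (partialV n L x u - partialV n L x v) (u - v) := by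
  have hC := hL.contDiff_two hk
  have hK : IsCompact ((Metric.closedBall (0 : E n) R ×ˢ Metric.closedBall (0 : E n) R) ×ˢ
      Metric.sphere (0 : E n) 1) :=
    ((isCompact_closedBall _ _).prod (isCompact_closedBall _ _)).prod (isCompact_sphere _ _)
  obtain ⟨lam, hlam, hle⟩ : ∃ lam > 0, ∀ x v w : E n, ‖x‖ ≤ R → ‖v‖ ≤ R → ‖w‖ = 1 →
      lam ≤ fiberHessian L x v w := by
    rcases ((Metric.closedBall (0 : E n) R ×ˢ Metric.closedBall (0 : E n) R) ×ˢ
      Metric.sphere (0 : E n) 1).eq_empty_or_nonempty with he | hne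
    · refine ⟨1, one_pos, fun x v w hx hv hw => ?_⟩
      have : ((x, v), w) ∈ (∅ : Set ((E n × E n) × E n)) := by
        rw [← he]; simp [hx, hv, hw]
      exact absurd this (by simp)
    · obtain ⟨q, hq, hmin⟩ := hK.exists_isMinOn hne (continuous_fiberHessian hC).continuousOn
      refine ⟨_, hL.fiberHessian_pos hk q.1.1 q.1.2 (w := q.2) ?_, fun x v w hx hv hw => ?_⟩
      · have : ‖q.2‖ = 1 := by simpa using hq.2
        intro h0
        simp [h0] at this
      · exact isMinOn_iff.1 hmin ((x, v), w) (by simp [hx, hv, hw])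
  refine ⟨lam, hlam, fun x v u hx hv hu => ?_⟩
  obtain ⟨ξ, hξ, h⟩ := exists_hasDerivAt_eq_slope
    (fun θ : ℝ => partialV n L x (v + θ • (u - v)) (u - v)) _ zero_lt_one
    (fun θ _ => (hasDerivAt_partialV_line hC x v (u - v) θ).continuousAt.continuousWithinAt)
    (fun θ _ => hasDerivAt_partialV_line hC x v (u - v) θ)
  have hball : ‖v + ξ • (u - v)‖ ≤ R := by
    have := (convex_closedBall (0 : E n) R).add_smul_sub_mem (x := v) (y := u) (by simpa using hv)
      (by simpa using hu) ⟨hξ.1.le, hξ.2.le⟩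
    simpa using this
  have hval : fiberHessian L x (v + ξ • (u - v)) (u - v) =
      (partialV n L x u - partialV n L x v) (u - v) := by
    rw [h]; simp
  rw [← hval]
  rcases eq_or_ne (u - v) 0 with h0 | h0
  · simp [h0, fiberHessian_zero]
  · have hn : ‖u - v‖ ≠ 0 := norm_ne_zero_iff.2 h0
    have h1 := hle x (v + ξ • (u - v)) (‖u - v‖⁻¹ • (u - v)) hx hball
      (by rw [norm_smul, norm_inv, norm_norm, inv_mul_cancel₀ hn])
    rw [fiberHessian_smul] at h1
    have hp : 0 < ‖u - v‖ := norm_pos_iff.2 h0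
    rw [inv_pow, inv_mul_eq_div, le_div_iff₀ (by positivity)] at h1
    exact h1

lemma exists_fderiv_lipschitz (hL : ContDiff ℝ 2 L) (R : ℝ) :
    ∃ C ≥ 0, ∀ z₁ z₂ : E n × E n, ‖z₁‖ ≤ R → ‖z₂‖ ≤ R →
      ‖fderiv ℝ L z₁ - fderiv ℝ L z₂‖ ≤ C * ‖z₁ - z₂‖ := by
  have h1 : ContDiff ℝ 1 (fderiv ℝ L) := hL.fderiv_right (by norm_num)
  obtain ⟨C, hC⟩ := (isCompact_closedBall (0 : E n × E n) R).exists_bound_of_continuousOn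
    (h1.continuous_fderiv one_ne_zero).continuousOn
  refine ⟨max C 0, le_max_right _ _, fun z₁ z₂ h₁ h₂ => ?_⟩
  refine (convex_closedBall (0 : E n × E n) R).norm_image_sub_le_of_norm_fderiv_le (𝕜 := ℝ)
    (fun z _ => h1.differentiable one_ne_zero z) (fun z hz => (hC z hz).trans (le_max_left _ _))
    (by simpa using h₂) (by simpa using h₁)

/-- Extremal curves are determined by their initial position and velocity. -/
lemma IsTonelliLagrangian.extremal_unique (hL : IsTonelliLagrangian n k L) (hk : 2 ≤ k)
    {γ₁ γ₂ : ℝ → E n} (h₁ : IsExtremal n L γ₁) (h₂ : IsExtremal n L γ₂)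
    (h0 : γ₁ 0 = γ₂ 0) (h0' : deriv γ₁ 0 = deriv γ₂ 0) {T : ℝ} (hT : 0 ≤ T) : γ₁ T = γ₂ T := by
  have hC := hL.contDiff_two hk
  have hd := hC.differentiable two_ne_zero
  have cont : ∀ {γ : ℝ → E n}, IsExtremal n L γ → Continuous γ ∧ Continuous (deriv γ) :=
    fun h => ⟨h.1.continuous, h.1.continuous_deriv (by norm_num)⟩
  have hder : ∀ {γ : ℝ → E n}, IsExtremal n L γ → ∀ t, HasDerivAt γ (deriv γ t) t :=
    fun h t => (h.1.differentiable two_ne_zero t).hasDerivAt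
  obtain ⟨R, hR⟩ := (isCompact_Icc (a := 0) (b := T)).exists_bound_of_continuousOn
    (f := fun t => ((γ₁ t, deriv γ₁ t), (γ₂ t, deriv γ₂ t)))
    (((cont h₁).1.prodMk (cont h₁).2).prodMk ((cont h₂).1.prodMk (cont h₂).2)).continuousOn
  simp only [Prod.norm_mk, sup_le_iff] at hR
  obtain ⟨lam, hlam, hconv⟩ := hL.exists_strong_convexity hk R
  obtain ⟨C, hC0, hlip⟩ := exists_fderiv_lipschitz hC R
  let f : ℝ → E n × (E n →L[ℝ] ℝ) := fun t =>
    (γ₁ t - γ₂ t, partialV n L (γ₁ t) (deriv γ₁ t) - partialV n L (γ₂ t) (deriv γ₂ t))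
  let f' : ℝ → E n × (E n →L[ℝ] ℝ) := fun t =>
    (deriv γ₁ t - deriv γ₂ t,
      partialX n L (γ₁ t) (deriv γ₁ t) - partialX n L (γ₂ t) (deriv γ₂ t))
  have hf : ∀ t, HasDerivAt f (f' t) t := fun t =>
    ((hder h₁ t).sub (hder h₂ t)).prodMk ((h₁.2 t).sub (h₂.2 t))
  have hnorm_inr : ‖ContinuousLinearMap.inr ℝ (E n) (E n)‖ ≤ 1 :=
    ContinuousLinearMap.opNorm_le_bound _ zero_le_one (fun w => by simp)
  have hnorm_inl : ‖ContinuousLinearMap.inl ℝ (E n) (E n)‖ ≤ 1 :=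
    ContinuousLinearMap.opNorm_le_bound _ zero_le_one (fun w => by simp)
  have hV : ∀ x v x' v' : E n, ‖(x, v)‖ ≤ R → ‖(x', v')‖ ≤ R →
      ‖partialV n L x v - partialV n L x' v'‖ ≤ C * ‖(x, v) - (x', v')‖ := by
    intro x v x' v' h h'
    rw [partialV_eq hd, partialV_eq hd, ← ContinuousLinearMap.sub_comp]
    refine (ContinuousLinearMap.opNorm_comp_le _ _).trans ?_
    exact (mul_le_of_le_one_right (norm_nonneg _) hnorm_inr).trans (hlip _ _ h h')
  have hX : ∀ x v x' v' : E n, ‖(x, v)‖ ≤ R → ‖(x', v')‖ ≤ R →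
      ‖partialX n L x v - partialX n L x' v'‖ ≤ C * ‖(x, v) - (x', v')‖ := by
    intro x v x' v' h h'
    rw [partialX_eq hd, partialX_eq hd, ← ContinuousLinearMap.sub_comp]
    refine (ContinuousLinearMap.opNorm_comp_le _ _).trans ?_
    exact (mul_le_of_le_one_right (norm_nonneg _) hnorm_inl).trans (hlip _ _ h h')
  have hbound : ∀ t ∈ Ico 0 T, ‖f' t‖ ≤ ((1 + C) * (1 + (1 + C) / lam)) * ‖f t‖ := by
    intro t ht
    obtain ⟨⟨hx₁, hv₁⟩, hx₂, hv₂⟩ := hR t ⟨ht.1, ht.2.le⟩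
    have hfd : ‖γ₁ t - γ₂ t‖ ≤ ‖f t‖ := norm_fst_le (f t)
    have hfq : ‖partialV n L (γ₁ t) (deriv γ₁ t) - partialV n L (γ₂ t) (deriv γ₂ t)‖ ≤ ‖f t‖ :=
      norm_snd_le (f t)
    have hvel : ‖deriv γ₁ t - deriv γ₂ t‖ ≤ (1 + C) / lam * ‖f t‖ := by
      have h1 := hconv (γ₁ t) (deriv γ₂ t) (deriv γ₁ t) hx₁ hv₂ hv₁
      have h2 : ‖partialV n L (γ₁ t) (deriv γ₁ t) - partialV n L (γ₁ t) (deriv γ₂ t)‖ ≤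
          (1 + C) * ‖f t‖ := by
        have h3 := hV (γ₂ t) (deriv γ₂ t) (γ₁ t) (deriv γ₂ t) (by simp [hx₂, hv₂])
          (by simp [hx₁, hv₂])
        rw [Prod.mk_sub_mk, sub_self, Prod.norm_mk, norm_zero, max_eq_left (norm_nonneg _),
          norm_sub_rev (γ₂ t)] at h3
        calc _ ≤ ‖partialV n L (γ₁ t) (deriv γ₁ t) - partialV n L (γ₂ t) (deriv γ₂ t)‖ +
              ‖partialV n L (γ₂ t) (deriv γ₂ t) - partialV n L (γ₁ t) (deriv γ₂ t)‖ :=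
              norm_sub_le_norm_sub_add_norm_sub _ _ _
          _ ≤ ‖f t‖ + C * ‖f t‖ := add_le_add hfq (h3.trans (by gcongr))
          _ = _ := by ring
      have h4 := (le_abs_self _).trans (ContinuousLinearMap.le_opNorm
        (partialV n L (γ₁ t) (deriv γ₁ t) - partialV n L (γ₁ t) (deriv γ₂ t))
        (deriv γ₁ t - deriv γ₂ t))
      rcases eq_or_lt_of_le (norm_nonneg (deriv γ₁ t - deriv γ₂ t)) with h5 | h5
      · rw [← h5]; positivity
      · rw [div_mul_eq_mul_div, le_div_iff₀ hlam]
        have h6 : lam * ‖deriv γ₁ t - deriv γ₂ t‖ ^ 2 ≤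
            (1 + C) * ‖f t‖ * ‖deriv γ₁ t - deriv γ₂ t‖ :=
          (h1.trans h4).trans (by gcongr)
        nlinarith
    have hone : 0 ≤ (1 + C) / lam := by positivity
    have hpair : ‖(γ₁ t, deriv γ₁ t) - (γ₂ t, deriv γ₂ t)‖ ≤ (1 + (1 + C) / lam) * ‖f t‖ := by
      rw [Prod.mk_sub_mk, Prod.norm_mk]
      refine max_le (hfd.trans ?_) (hvel.trans ?_)
      · nlinarith [norm_nonneg (f t)]
      · nlinarith [norm_nonneg (f t)]
    have hforce := (hX (γ₁ t) (deriv γ₁ t) (γ₂ t) (deriv γ₂ t) (by simp [hx₁, hv₁])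
      (by simp [hx₂, hv₂])).trans (mul_le_mul_of_nonneg_left hpair hC0)
    have hnn : 0 ≤ (1 + (1 + C) / lam) * ‖f t‖ := by positivity
    rw [Prod.norm_mk]
    refine max_le (hvel.trans ?_) (hforce.trans ?_)
    · nlinarith [norm_nonneg (f t)]
    · nlinarith
  have hzero := eq_zero_of_abs_deriv_le_mul_abs_self_of_eq_zero_right
    (fun t _ => (hf t).continuousAt.continuousWithinAt) (fun t _ => (hf t).hasDerivWithinAt)
    (by simp [f, h0, h0']) hbound T ⟨hT, le_rfl⟩
  exact sub_eq_zero.1 (congrArg Prod.fst hzero)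

end LagrangianCalculus

section Energy
open Set Filter Topology

variable {n : ℕ} {L : E n × E n → ℝ} {k : ℕ∞}

lemma IsTonelliLagrangian.exists_bound (hL : IsTonelliLagrangian n k L) (hk : 2 ≤ k) (R : ℝ) :
    ∃ M ≥ 0, ∀ x v : E n, ‖v‖ ≤ R → |L (x, v)| ≤ M := by
  have hc : Continuous L := (hL.contDiff_two hk).continuous
  obtain ⟨M, hM⟩ := ((isCompact_closedBall (0 : E n) 1).prod
    (isCompact_closedBall (0 : E n) R)).exists_bound_of_continuousOn hc.continuousOn
  refine ⟨max M 0, le_max_right _ _, fun x v hv => ?_⟩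
  have hx : ‖x + intVec fun i => -⌊x i⌋‖ ≤ 1 := by
    rw [pi_norm_le_iff_of_nonneg zero_le_one]
    intro i
    have h1 := Int.floor_le (x i)
    have h2 := Int.lt_floor_add_one (x i)
    simp only [intVec, Pi.add_apply, Int.cast_neg, Real.norm_eq_abs]
    rw [abs_le]
    constructor <;> linarith
  rw [← hL.periodic x v fun i => -⌊x i⌋]
  exact (hM (_, v) (by simp [hx, hv])).trans (le_max_left _ _)

lemma IsTonelliLagrangian.exists_norm_sub_le (hL : IsTonelliLagrangian n k L) (hk : 2 ≤ k) :
    ∃ m ≥ 0, ∀ x v : E n, ‖v‖ - m ≤ L (x, v) := by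
  obtain ⟨R, hR⟩ := hL.superlinear 1
  obtain ⟨M, hM0, hM⟩ := hL.exists_bound hk R
  refine ⟨|R| + M, by positivity, fun x v => ?_⟩
  rcases le_total R ‖v‖ with h | h
  · have := hR x v h
    have := abs_nonneg R
    linarith
  · have := (abs_le.1 (hM x v h)).1
    have := le_abs_self R
    linarith

/-- The energy of a Lagrangian. -/
def energy (L : E n × E n → ℝ) (x v : E n) : ℝ := partialV n L x v v - L (x, v)

lemma IsTonelliLagrangian.exists_energy_le (hL : IsTonelliLagrangian n k L) (hk : 2 ≤ k)
    (R : ℝ) : ∃ M, ∀ x v : E n, ‖v‖ ≤ R → energy L x v ≤ M := by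
  obtain ⟨M₁, -, hM₁⟩ := hL.exists_bound hk R
  obtain ⟨M₂, -, hM₂⟩ := hL.exists_bound hk (2 * R)
  refine ⟨M₂ + 2 * M₁, fun x v hv => ?_⟩
  have h1 := hL.add_partialV_le hk x v (v + v)
  have h2 := (abs_le.1 (hM₁ x v hv)).1
  have h3 := (abs_le.1 (hM₂ x (v + v) ((norm_add_le _ _).trans (by linarith)))).2
  rw [add_sub_cancel_right] at h1
  simp only [energy]
  linarith

/-- The energy is coercive in the fibers. -/
lemma IsTonelliLagrangian.exists_norm_le_of_energy_le (hL : IsTonelliLagrangian n k L)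
    (hk : 2 ≤ k) (M : ℝ) : ∃ R, ∀ x v : E n, energy L x v ≤ M → ‖v‖ ≤ R := by
  obtain ⟨D, hD0, hD⟩ := hL.exists_bound hk 1
  obtain ⟨R, hR⟩ := hL.superlinear (M + 2 * D + 1)
  refine ⟨max R 1, fun x v h => ?_⟩
  by_contra! hlt
  have hRv : R ≤ ‖v‖ := (le_max_left _ _).trans hlt.le
  have hv1 : 1 < ‖v‖ := (le_max_right _ _).trans_lt hlt
  have hv0 : 0 < ‖v‖ := by linarith
  have h1 := hR x v hRv
  have h2 := hL.add_partialV_le hk x v 0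
  have h3 := hL.add_partialV_le hk x v (‖v‖⁻¹ • v)
  have h4 := (abs_le.1 (hD x 0 (by simp))).2
  have h5 := (abs_le.1 (hD x (‖v‖⁻¹ • v)
    (by rw [norm_smul, norm_inv, norm_norm, inv_mul_cancel₀ hv0.ne']))).2
  simp only [zero_sub, map_neg, map_sub, map_smul, smul_eq_mul] at h2 h3
  simp only [energy] at h
  set p := partialV n L x v v
  have h6 : (M + 2 * D + 1) * ‖v‖ - D ≤ p := by linarith
  have h7 : ‖v‖⁻¹ * ((M + 2 * D + 1) * ‖v‖ - D) ≤ ‖v‖⁻¹ * p := by gcongr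
  have h8 : ‖v‖⁻¹ * ((M + 2 * D + 1) * ‖v‖ - D) = (M + 2 * D + 1) - ‖v‖⁻¹ * D := by
    field_simp
  have h9 : ‖v‖⁻¹ * D ≤ D := mul_le_of_le_one_left hD0 (inv_le_one_of_one_le₀ hv1.le)
  linarith

/-- Conservation of energy along extremal curves. -/
lemma IsExtremal.energy_eq {γ : ℝ → E n} (hL : Differentiable ℝ L) (h : IsExtremal n L γ)
    (s t : ℝ) : energy L (γ s) (deriv γ s) = energy L (γ t) (deriv γ t) := by
  have h1 : ∀ t, HasDerivAt γ (deriv γ t) t := fun t =>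
    (h.1.differentiable two_ne_zero t).hasDerivAt
  have h2 : ∀ t, HasDerivAt (deriv γ) (deriv (deriv γ) t) t := fun t =>
    ((h.1.iterate_deriv' 1 1).differentiable one_ne_zero t).hasDerivAt
  have h3 : ∀ t, HasDerivAt (fun t => energy L (γ t) (deriv γ t)) 0 t := by
    intro t
    have e1 := (h.2 t).clm_apply (h2 t)
    have e2 := (hL (γ t, deriv γ t)).hasFDerivAt.comp_hasDerivAt t ((h1 t).prodMk (h2 t))
    rw [fderiv_apply_eq_partials hL] at e2
    have e3 := e1.sub e2
    rw [sub_self] at e3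
    exact e3
  exact is_const_of_deriv_eq_zero (fun t => (h3 t).differentiableAt) (fun t => (h3 t).deriv) s t

end Energy

section FirstVariation
open Set Filter Topology

/-- Differentiation under the integral sign for `C¹` integrands. -/
lemma hasFDerivAt_intervalIntegral_of_contDiff {V W : Type*} [NormedAddCommGroup V]
    [NormedSpace ℝ V] [FiniteDimensional ℝ V] [NormedAddCommGroup W] [NormedSpace ℝ W]
    {f : ℝ × V → W} (hf : ContDiff ℝ 1 f) (a b : ℝ) (v : V) :
    HasFDerivAt (fun v => ∫ s in a..b, f (s, v))
      (∫ s in a..b, (fderiv ℝ f (s, v)).comp (ContinuousLinearMap.inr ℝ ℝ V)) v := by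
  have hf' : Continuous fun q : ℝ × V => (fderiv ℝ f q).comp (ContinuousLinearMap.inr ℝ ℝ V) :=
    (hf.continuous_fderiv one_ne_zero).clm_comp continuous_const
  obtain ⟨C, hC⟩ := ((isCompact_uIcc (a := a) (b := b)).prod
    (isCompact_closedBall v 1)).exists_bound_of_continuousOn hf'.continuousOn
  refine intervalIntegral.hasFDerivAt_integral_of_dominated_of_fderiv_le (bound := fun _ => C)
    (F' := fun v s => (fderiv ℝ f (s, v)).comp (ContinuousLinearMap.inr ℝ ℝ V))
    (F := fun v s => f (s, v)) (Metric.closedBall_mem_nhds v one_pos) ?_ ?_ ?_ ?_ ?_ ?_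
  · exact Eventually.of_forall fun u =>
      (hf.continuous.comp (by fun_prop : Continuous fun s : ℝ => (s, u))).aestronglyMeasurable
  · exact (hf.continuous.comp (by fun_prop : Continuous fun s : ℝ => (s, v))).intervalIntegrable _ _
  · exact (hf'.comp (by fun_prop : Continuous fun s : ℝ => (s, v))).aestronglyMeasurable
  · exact Eventually.of_forall fun s hs u hu => hC (s, u) ⟨uIoc_subset_uIcc hs, hu⟩
  · exact intervalIntegrable_const
  · exact Eventually.of_forall fun s hs u hu =>
      (hf.differentiable one_ne_zero (s, u)).hasFDerivAt.comp u (hasFDerivAt_prodMk_right s u)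

variable {n : ℕ} {L : E n × E n → ℝ}

/-- `F` and `w` are the positions and velocities of a `C¹` family of extremal curves issuing from
the point `x`. -/
structure IsExtremalFan (L : E n × E n → ℝ) (x : E n) (F w : ℝ × E n → E n) : Prop where
  contDiff_fst : ContDiff ℝ 1 F
  contDiff_snd : ContDiff ℝ 1 w
  extremal : ∀ v, IsExtremal n L fun t => F (t, v)
  velocity : ∀ t v, w (t, v) = deriv (fun s => F (s, v)) t
  zero : ∀ v, F (0, v) = x
  velocity_zero : ∀ v, w (0, v) = v

/-- The partial derivative of `F (t, v)` with respect to `v`. -/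
def derivSnd {V W : Type*} [NormedAddCommGroup V] [NormedSpace ℝ V] [NormedAddCommGroup W]
    [NormedSpace ℝ W] (F : ℝ × V → W) (q : ℝ × V) : V →L[ℝ] W :=
  (fderiv ℝ F q).comp (ContinuousLinearMap.inr ℝ ℝ V)

lemma continuous_derivSnd {V W : Type*} [NormedAddCommGroup V] [NormedSpace ℝ V]
    [NormedAddCommGroup W] [NormedSpace ℝ W] {F : ℝ × V → W} (hF : ContDiff ℝ 1 F) :
    Continuous (derivSnd F) :=
  (hF.continuous_fderiv one_ne_zero).clm_comp continuous_const

lemma hasFDerivAt_derivSnd {V W : Type*} [NormedAddCommGroup V] [NormedSpace ℝ V]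
    [NormedAddCommGroup W] [NormedSpace ℝ W] {F : ℝ × V → W} (hF : ContDiff ℝ 1 F) (t : ℝ) (v : V) :
    HasFDerivAt (fun v => F (t, v)) (derivSnd F (t, v)) v :=
  (hF.differentiable one_ne_zero (t, v)).hasFDerivAt.comp v (hasFDerivAt_prodMk_right t v)

/-- The Lagrangian action of a curve of a family of curves on `[0, t]`. -/
def fanAction (L : E n × E n → ℝ) (F w : ℝ × E n → E n) (t : ℝ) (v : E n) : ℝ :=
  ∫ s in (0:ℝ)..t, L (F (s, v), w (s, v))

namespace IsExtremalFan

variable {x : E n} {F w : ℝ × E n → E n}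

lemma hasDerivAt (h : IsExtremalFan L x F w) (t : ℝ) (v : E n) :
    HasDerivAt (fun s => F (s, v)) (w (t, v)) t := by
  rw [h.velocity]
  exact ((h.extremal v).1.differentiable two_ne_zero t).hasDerivAt

lemma eq_add_integral (h : IsExtremalFan L x F w) (t : ℝ) (v : E n) :
    F (t, v) = x + ∫ s in (0:ℝ)..t, w (s, v) := by
  rw [intervalIntegral.integral_eq_sub_of_hasDerivAt (fun s _ => h.hasDerivAt s v)
    ((h.contDiff_snd.continuous.comp
      (by fun_prop : Continuous fun s : ℝ => (s, v))).intervalIntegrable _ _), h.zero]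
  abel

lemma hasDerivAt_derivSnd (h : IsExtremalFan L x F w) (t : ℝ) (v : E n) :
    HasDerivAt (fun s => derivSnd F (s, v)) (derivSnd w (t, v)) t := by
  have h1 : (fun s => derivSnd F (s, v)) = fun t => ∫ s in (0:ℝ)..t, derivSnd w (s, v) := by
    ext1 t
    refine (hasFDerivAt_derivSnd h.contDiff_fst t v).unique ?_
    simp_rw [h.eq_add_integral t]
    exact (hasFDerivAt_intervalIntegral_of_contDiff h.contDiff_snd 0 t v).const_add x
  have hc : Continuous fun s => derivSnd w (s, v) :=
    (continuous_derivSnd h.contDiff_snd).comp (by fun_prop)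
  rw [h1]
  exact intervalIntegral.integral_hasDerivAt_right (hc.intervalIntegrable _ _)
    hc.aestronglyMeasurable.stronglyMeasurableAtFilter hc.continuousAt

lemma derivSnd_zero (h : IsExtremalFan L x F w) (v : E n) : derivSnd F (0, v) = 0 := by
  refine (hasFDerivAt_derivSnd h.contDiff_fst 0 v).unique ?_
  simp_rw [h.zero]
  exact hasFDerivAt_const x v

/-- First variation formula. -/
lemma hasFDerivAt_action (hL : ContDiff ℝ 2 L) (h : IsExtremalFan L x F w) (t : ℝ) (v : E n) :
    HasFDerivAt (fanAction L F w t)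
      ((partialV n L (F (t, v)) (w (t, v))).comp (derivSnd F (t, v))) v := by
  have hd := hL.differentiable two_ne_zero
  have hLF : ContDiff ℝ 1 fun q : ℝ × E n => L (F q, w q) :=
    (hL.of_le one_le_two).comp (h.contDiff_fst.prodMk h.contDiff_snd)
  have h1 := hasFDerivAt_intervalIntegral_of_contDiff hLF 0 t v
  have h2 : ∀ s, HasDerivAt
      (fun s => (partialV n L (F (s, v)) (w (s, v))).comp (derivSnd F (s, v)))
      (derivSnd (fun q : ℝ × E n => L (F q, w q)) (s, v)) s := by
    intro s
    have e1 : HasDerivAt (fun s => partialV n L (F (s, v)) (w (s, v)))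
        (partialX n L (F (s, v)) (w (s, v))) s := by
      simpa only [← h.velocity] using (h.extremal v).2 s
    have e2 := e1.clm_comp (h.hasDerivAt_derivSnd s v)
    have e3 : derivSnd (fun q : ℝ × E n => L (F q, w q)) (s, v) =
        (fderiv ℝ L (F (s, v), w (s, v))).comp
          ((derivSnd F (s, v)).prod (derivSnd w (s, v))) :=
      (hasFDerivAt_derivSnd hLF s v).unique
        ((hd _).hasFDerivAt.comp v ((hasFDerivAt_derivSnd h.contDiff_fst s v).prodMk
          (hasFDerivAt_derivSnd h.contDiff_snd s v)))
    rw [e3]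
    convert e2 using 1
    ext1 u
    exact fderiv_apply_eq_partials hd _ _ _ _
  have h3 : (∫ s in (0:ℝ)..t, (fderiv ℝ (fun q : ℝ × E n => L (F q, w q)) (s, v)).comp
      (ContinuousLinearMap.inr ℝ ℝ (E n))) =
      (partialV n L (F (t, v)) (w (t, v))).comp (derivSnd F (t, v)) := by
    have := intervalIntegral.integral_eq_sub_of_hasDerivAt (a := 0) (b := t) (fun s _ => h2 s)
      (((continuous_derivSnd hLF).comp
        (by fun_prop : Continuous fun s : ℝ => (s, v))).intervalIntegrable _ _)
    rw [h.derivSnd_zero, ContinuousLinearMap.comp_zero, sub_zero] at this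
    exact this
  rw [h3] at h1
  exact h1

lemma hasFDerivAt_uncurry_action (hL : ContDiff ℝ 2 L) (h : IsExtremalFan L x F w) (q : ℝ × E n) :
    HasFDerivAt (fun q : ℝ × E n => fanAction L F w q.1 q.2)
      ((ContinuousLinearMap.toSpanSingleton ℝ (L (F q, w q))).coprod
        ((partialV n L (F q) (w q)).comp (derivSnd F q))) q := by
  have hLF : Continuous fun q : ℝ × E n => L (F q, w q) :=
    hL.continuous.comp (h.contDiff_fst.continuous.prodMk h.contDiff_snd.continuous)
  have hFw : Continuous fun q : ℝ × E n => (F q, w q) :=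
    h.contDiff_fst.continuous.prodMk h.contDiff_snd.continuous
  refine (hasStrictFDerivAt_uncurry_coprod (f := fanAction L F w)
    (f₁ := fun t v => ContinuousLinearMap.toSpanSingleton ℝ (L (F (t, v), w (t, v))))
    (f₂ := fun t v => (partialV n L (F (t, v)) (w (t, v))).comp (derivSnd F (t, v)))
    (Eventually.of_forall fun y => ?_) (Eventually.of_forall fun y => ?_) ?_ ?_).hasFDerivAt
  · have hc : Continuous fun s => L (F (s, y.2), w (s, y.2)) :=
      hLF.comp (by fun_prop : Continuous fun s : ℝ => (s, y.2))
    exact (intervalIntegral.integral_hasDerivAt_right (hc.intervalIntegrable _ _)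
      hc.aestronglyMeasurable.stronglyMeasurableAtFilter hc.continuousAt).hasFDerivAt
  · exact h.hasFDerivAt_action hL y.1 y.2
  · have : Continuous fun q : ℝ × E n =>
        ContinuousLinearMap.toSpanSingleton ℝ (L (F q, w q)) :=
      (ContinuousLinearMap.toSpanSingletonCLE (𝕜 := ℝ) (E := ℝ)).continuous.comp hLF
    exact this.continuousAt
  · have : Continuous fun q : ℝ × E n => (partialV n L (F q) (w q)).comp (derivSnd F q) :=
      ((continuous_partialV (hL.of_le one_le_two)).comp hFw).clm_comp
        (continuous_derivSnd h.contDiff_fst)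
    exact this.continuousAt

end IsExtremalFan

end FirstVariation

section Bijectivity
open Set Filter Topology

variable {n : ℕ} {L : E n × E n → ℝ} {k : ℕ∞}

namespace IsExtremalFan

variable {x : E n} {F w : ℝ × E n → E n}

lemma fderiv_apply (h : IsExtremalFan L x F w) (t : ℝ) (v : E n) (r : ℝ) (u : E n) :
    fderiv ℝ F (t, v) (r, u) = r • w (t, v) + derivSnd F (t, v) u := by
  have hd := (h.contDiff_fst.differentiable one_ne_zero (t, v)).hasFDerivAt
  have h1 : HasDerivAt (fun s => F (s, v)) (fderiv ℝ F (t, v) (1, 0)) t :=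
    hd.comp_hasDerivAt t ((hasDerivAt_id t).prodMk (hasDerivAt_const t v))
  rw [(h.hasDerivAt t v).unique h1, derivSnd, ← map_smul, ContinuousLinearMap.comp_apply,
    ← map_add]
  simp

lemma contDiff_expTime (h : IsExtremalFan L x F w) :
    ContDiff ℝ 1 fun q : ℝ × E n => F (Real.exp q.1, q.2) :=
  h.contDiff_fst.comp ((Real.contDiff_exp.comp _root_.contDiff_fst).prodMk _root_.contDiff_snd)

lemma eq_zero_of_fderiv_expTime (h : IsExtremalFan L x F w)
    (hnd : ∀ t > 0, ∀ v u, derivSnd F (t, v) u = 0 → u = 0) (z : ℝ × E n) (u : E n)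
    (hu : fderiv ℝ (fun q : ℝ × E n => F (Real.exp q.1, q.2)) z (0, u) = 0) : u = 0 := by
  refine hnd (Real.exp z.1) (Real.exp_pos _) z.2 u ?_
  rw [← hu]
  exact congrArg (fun A : E n →L[ℝ] E n => A u)
    ((hasFDerivAt_derivSnd h.contDiff_fst (Real.exp z.1) z.2).unique
      (hasFDerivAt_derivSnd h.contDiff_expTime z.1 z.2))

/-- Extremal curves issuing from a given point with bounded action over a time bounded away from
zero have bounded initial velocity. -/
lemma exists_norm_le_of_action_le (hL : IsTonelliLagrangian n k L) (hk : 2 ≤ k)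
    (h : IsExtremalFan L x F w) {t₀ : ℝ} (ht₀ : 0 < t₀) (A : ℝ) :
    ∃ R, ∀ t ≥ t₀, ∀ v, fanAction L F w t v ≤ A → ‖v‖ ≤ R := by
  have hC := hL.contDiff_two hk
  obtain ⟨m, hm0, hm⟩ := hL.exists_norm_sub_le hk
  obtain ⟨M, hM⟩ := hL.exists_energy_le hk (m + |A| / t₀ + 1)
  obtain ⟨R, hR⟩ := hL.exists_norm_le_of_energy_le hk M
  refine ⟨R, fun t ht v hA => ?_⟩
  have ht0 : 0 < t := ht₀.trans_le ht
  obtain ⟨s, hs⟩ : ∃ s, ‖w (s, v)‖ ≤ m + |A| / t₀ + 1 := by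
    by_contra! hcon
    have hint : Continuous fun s => L (F (s, v), w (s, v)) :=
      hC.continuous.comp ((h.contDiff_fst.continuous.prodMk h.contDiff_snd.continuous).comp
        (by fun_prop : Continuous fun s : ℝ => (s, v)))
    have h1 : ∫ _ in (0:ℝ)..t, (|A| / t₀ + 1) ≤ fanAction L F w t v :=
      intervalIntegral.integral_mono_on ht0.le intervalIntegrable_const
        (hint.intervalIntegrable _ _) fun s _ => by
          have := hm (F (s, v)) (w (s, v))
          have := hcon s
          linarith
    rw [intervalIntegral.integral_const, sub_zero, smul_eq_mul] at h1
    have h2 : t₀ * (|A| / t₀ + 1) ≤ t * (|A| / t₀ + 1) := by gcongr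
    have h3 : t₀ * (|A| / t₀ + 1) = |A| + t₀ := by field_simp
    have := le_abs_self A
    linarith
  have he := (h.extremal v).energy_eq (hC.differentiable two_ne_zero) 0 s
  simp only [← h.velocity, h.zero, h.velocity_zero] at he
  exact hR x v (he ▸ hM _ _ hs)

/-- The action of the end points of a lift of a curve `c`, in exponential time, is bounded by the
action of `c`. -/
lemma action_le_of_lift (hL : IsTonelliLagrangian n k L) (hk : 2 ≤ k)
    (h : IsExtremalFan L x F w)
    (hnd : ∀ t > 0, ∀ v u, derivSnd F (t, v) u = 0 → u = 0)
    {c : ℝ → E n} (hc : ContDiff ℝ 1 c) {a s M : ℝ} (has : a ≤ s) {v : E n} {γ : ℝ → E n}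
    (hM : ∀ t ∈ Icc a s, Real.exp t * L (c t, (Real.exp t)⁻¹ • deriv c t) ≤ M)
    (hγ : IsLiftOn (fun q : ℝ × E n => F (Real.exp q.1, q.2)) c a s v γ) :
    fanAction L F w (Real.exp s) (γ s) ≤ fanAction L F w (Real.exp a) v + M * (s - a) := by
  have hC := hL.contDiff_two hk
  have hG := h.contDiff_expTime
  have hinj := h.eq_zero_of_fderiv_expTime hnd
  let Ψ : ℝ → ℝ := fun t => fanAction L F w (Real.exp t) (γ t) - M * t
  have hder : ∀ t ∈ Ioo a s, ∃ d ≤ 0, HasDerivAt Ψ d t := by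
    intro t ht
    have hnhds : Icc a s ∈ 𝓝 t := Icc_mem_nhds ht.1 ht.2
    have hev : ∀ᶠ r in 𝓝 t, F (Real.exp r, γ r) = c r := by
      filter_upwards [hnhds] with r hr using hγ.2.2 r hr
    have hcd : HasDerivAt c (deriv c t) t := (hc.differentiable one_ne_zero t).hasDerivAt
    have hγd : HasDerivAt γ (deriv γ t) t :=
      (differentiableAt_of_lift hG hinj hcd.differentiableAt
        (hγ.1.continuousAt hnhds) hev).hasDerivAt
    have hq : HasDerivAt (fun r => (Real.exp r, γ r)) (Real.exp t, deriv γ t) t :=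
      (Real.hasDerivAt_exp t).prodMk hγd
    have e1 := ((h.contDiff_fst.differentiable one_ne_zero _).hasFDerivAt.comp_hasDerivAt t hq)
    rw [h.fderiv_apply] at e1
    have e2 : Real.exp t • w (Real.exp t, γ t) + derivSnd F (Real.exp t, γ t) (deriv γ t) =
        deriv c t :=
      e1.unique (hcd.congr_of_eventuallyEq hev)
    have e3 := (h.hasFDerivAt_uncurry_action hC (Real.exp t, γ t)).comp_hasDerivAt t hq
    refine ⟨_, ?_, e3.sub ((hasDerivAt_id t).const_mul M)⟩
    have hFc : F (Real.exp t, γ t) = c t := hγ.2.2 t ⟨ht.1.le, ht.2.le⟩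
    have h4 := hL.add_partialV_le hk (c t) (w (Real.exp t, γ t)) ((Real.exp t)⁻¹ • deriv c t)
    have hpos := Real.exp_pos t
    have h5 := mul_le_mul_of_nonneg_left h4 hpos.le
    have h6 := hM t ⟨ht.1.le, ht.2.le⟩
    have h7 : derivSnd F (Real.exp t, γ t) (deriv γ t) =
        Real.exp t • ((Real.exp t)⁻¹ • deriv c t - w (Real.exp t, γ t)) := by
      rw [smul_sub, smul_inv_smul₀ hpos.ne', ← e2]
      abel
    rw [ContinuousLinearMap.coprod_apply, ContinuousLinearMap.comp_apply, h7, hFc, map_smul,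
      ContinuousLinearMap.toSpanSingleton_apply, smul_eq_mul, smul_eq_mul]
    linarith
  have hcont : ContinuousOn Ψ (Icc a s) := by
    have h1 : Continuous fun q : ℝ × E n => fanAction L F w q.1 q.2 :=
      continuous_iff_continuousAt.2 fun q => (h.hasFDerivAt_uncurry_action hC q).continuousAt
    exact (h1.comp_continuousOn (Real.continuous_exp.continuousOn.prodMk hγ.1)).sub
      (by fun_prop)
  have hanti : AntitoneOn Ψ (Icc a s) := by
    refine antitoneOn_of_deriv_nonpos (convex_Icc a s) hcont ?_ ?_
    · intro t ht
      rw [interior_Icc] at ht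
      obtain ⟨d, -, hd⟩ := hder t ht
      exact hd.differentiableAt.differentiableWithinAt
    · intro t ht
      rw [interior_Icc] at ht
      obtain ⟨d, hd0, hd⟩ := hder t ht
      rw [hd.deriv]
      exact hd0
  have := hanti (left_mem_Icc.2 has) (right_mem_Icc.2 has) has
  simp only [Ψ, hγ.2.1] at this
  linarith

/-- In the absence of conjugate points, any two points are joined by exactly one extremal curve in
a given positive time. -/
lemma bijective (hL : IsTonelliLagrangian n k L) (hk : 2 ≤ k) (h : IsExtremalFan L x F w)
    (hnd : ∀ t > 0, ∀ v u, derivSnd F (t, v) u = 0 → u = 0) {T : ℝ} (hT : 0 < T) :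
    Function.Bijective fun v => F (T, v) := by
  have hC := hL.contDiff_two hk
  have := bijective_of_lift_bound h.contDiff_expTime
    (h.eq_zero_of_fderiv_expTime hnd) (fun c hc a b v hab hv => ?_) (Real.log T)
  · simpa only [Real.exp_log hT] using this
  · have hcont : Continuous fun t => Real.exp t * L (c t, (Real.exp t)⁻¹ • deriv c t) := by
      have h1 := hC.continuous
      have h2 := hc.continuous
      have h3 := hc.continuous_deriv le_rfl
      have h4 : Continuous fun t => (Real.exp t)⁻¹ :=
        Real.continuous_exp.inv₀ fun t => (Real.exp_pos t).ne'
      fun_prop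
    obtain ⟨M, hM⟩ := (isCompact_Icc (a := a) (b := b)).exists_bound_of_continuousOn
      hcont.continuousOn
    have hM0 : 0 ≤ M := (norm_nonneg _).trans (hM a (left_mem_Icc.2 hab))
    obtain ⟨R, hR⟩ := h.exists_norm_le_of_action_le hL hk (Real.exp_pos a)
      (fanAction L F w (Real.exp a) v + M * (b - a))
    refine ⟨R, fun s hs γ hγ => hR (Real.exp s) (Real.exp_le_exp.2 hs.1) _ ?_⟩
    refine (h.action_le_of_lift hL hk hnd hc hs.1
      (fun t ht => (le_abs_self _).trans (hM t ⟨ht.1, ht.2.trans hs.2⟩)) hγ).trans ?_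
    have := hs.2
    gcongr

end IsExtremalFan

end Bijectivity

section Flow
open Set Filter Topology

variable {n : ℕ} {L : E n × E n → ℝ}

namespace IsTonelliLagrangian

variable {k : ℕ∞}

lemma partialV_add_intVec (hL : IsTonelliLagrangian n k L) (x v : E n) (m : Fin n → ℤ) :
    partialV n L (x + intVec m) v = partialV n L x v := by
  simp only [partialV, hL.periodic]

lemma partialX_add_intVec (hL : IsTonelliLagrangian n k L) (x v : E n) (m : Fin n → ℤ) :
    partialX n L (x + intVec m) v = partialX n L x v := by
  rw [partialX, ← fderiv_comp_add_right]
  simp only [partialX, hL.periodic]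

/-- Integer translates of extremal curves are extremal curves. -/
lemma isExtremal_add_intVec (hL : IsTonelliLagrangian n k L) {γ : ℝ → E n}
    (h : IsExtremal n L γ) (m : Fin n → ℤ) : IsExtremal n L fun t => γ t + intVec m := by
  refine ⟨h.1.add contDiff_const, fun t => ?_⟩
  simp only [deriv_add_const, hL.partialV_add_intVec, hL.partialX_add_intVec]
  exact h.2 t

end IsTonelliLagrangian

namespace IsELFlow

variable {k : ℕ} {φ : ℝ → E n × E n → E n × E n}

lemma contDiff_one (hφ : IsELFlow n k L φ) (hk : 2 ≤ k) :
    ContDiff ℝ 1 fun p : ℝ × (E n × E n) => φ p.1 p.2 :=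
  hφ.1.of_le (by exact_mod_cast (by omega : 1 ≤ k - 1))

/-- The Euler–Lagrange flow commutes with integer translations. -/
lemma fst_add_intVec (hφ : IsELFlow n k L φ) (hk : 2 ≤ k) (hL : IsTonelliLagrangian n k L)
    {T : ℝ} (hT : 0 ≤ T) (x v : E n) (m : Fin n → ℤ) :
    (φ T (x + intVec m, v)).1 = (φ T (x, v)).1 + intVec m := by
  refine hL.extremal_unique (by exact_mod_cast hk) (hφ.2.2 (x + intVec m) v).1
    (hL.isExtremal_add_intVec (hφ.2.2 x v).1 m) ?_ ?_ hT
  · simp only [hφ.2.1]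
  · rw [deriv_add_const, ← (hφ.2.2 x v).2, ← (hφ.2.2 _ v).2, hφ.2.1, hφ.2.1]

lemma isExtremalFan (hφ : IsELFlow n k L φ) (hk : 2 ≤ k) (x : E n) :
    IsExtremalFan L x (fun q => (φ q.1 (x, q.2)).1) (fun q => (φ q.1 (x, q.2)).2) := by
  have h : ContDiff ℝ 1 fun q : ℝ × E n => φ q.1 (x, q.2) :=
    (hφ.contDiff_one hk).comp (contDiff_fst.prodMk (contDiff_const.prodMk contDiff_snd))
  exact
    { contDiff_fst := contDiff_fst.comp h
      contDiff_snd := contDiff_snd.comp h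
      extremal := fun v => (hφ.2.2 x v).1
      velocity := fun t v => (hφ.2.2 x v).2 t
      zero := fun v => by simp only [hφ.2.1]
      velocity_zero := fun v => by simp only [hφ.2.1] }

lemma differentiable (hφ : IsELFlow n k L φ) (hk : 2 ≤ k) (t : ℝ) : Differentiable ℝ (φ t) :=
  ((hφ.contDiff_one hk).comp (contDiff_prodMk_right t)).differentiable one_ne_zero

lemma derivSnd_apply (hφ : IsELFlow n k L φ) (hk : 2 ≤ k) (x : E n) (t : ℝ) (v u : E n) :
    derivSnd (fun q : ℝ × E n => (φ q.1 (x, q.2)).1) (t, v) u =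
      (fderiv ℝ (φ t) (x, v) (0, u)).1 :=
  congrArg (fun A : E n →L[ℝ] E n => A u)
    ((hasFDerivAt_derivSnd (hφ.isExtremalFan hk x).contDiff_fst t v).unique
      ((hφ.differentiable hk t (x, v)).hasFDerivAt.comp v (hasFDerivAt_prodMk_right x v)).fst)

/-- Without conjugate points, any two points of `ℝⁿ` are joined by exactly one extremal curve in a
given positive time. -/
lemma bijective (hφ : IsELFlow n k L φ) (hk : 2 ≤ k) (hL : IsTonelliLagrangian n k L)
    (hnc : NoConjugatePoints n φ) {T : ℝ} (hT : 0 < T) (x : E n) :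
    Function.Bijective fun v => (φ T (x, v)).1 :=
  (hφ.isExtremalFan hk x).bijective hL (by exact_mod_cast hk)
    (fun t ht v u hu => hnc (x, v) t ht.ne' u (by rwa [← hφ.derivSnd_apply hk])) hT

end IsELFlow

/-- The implicit function theorem for a globally defined, unique solution. -/
lemma contDiff_of_unique_solution {P V : Type*} [NormedAddCommGroup P] [NormedSpace ℝ P]
    [NormedAddCommGroup V] [NormedSpace ℝ V] [FiniteDimensional ℝ P] [FiniteDimensional ℝ V]
    {m : ℕ∞} (hm : 1 ≤ m) {F : P × V → V} (hF : ContDiff ℝ m F)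
    (hinj : ∀ z u, fderiv ℝ F z (0, u) = 0 → u = 0) {X : P → V} {c : V}
    (hX : ∀ x v, F (x, v) = c ↔ v = X x) : ContDiff ℝ m X := by
  refine contDiff_iff_contDiffAt.2 fun x₀ => ?_
  obtain ⟨e, e', hs, he, hd⟩ := exists_openPartialHomeomorph_graph
    (hF.of_le (by exact_mod_cast hm)) (x₀, X x₀) (hinj _)
  have he₀ : e (x₀, X x₀) = (x₀, c) := by rw [he, (hX x₀ _).2 rfl]
  have ht : (x₀, c) ∈ e.target := he₀ ▸ e.map_source hs
  have hsymm : e.symm (x₀, c) = (x₀, X x₀) := by rw [← he₀, e.left_inv hs]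
  have hes : ContDiffAt ℝ m e.symm (x₀, c) := by
    refine e.contDiffAt_symm ht (f₀' := e') (by rwa [hsymm]) ?_
    rw [funext he]
    exact (contDiff_fst.prodMk hF).contDiffAt
  have hpair : ContDiffAt ℝ m (fun x : P => (x, c)) x₀ := contDiffAt_id.prodMk contDiffAt_const
  refine (contDiffAt_snd.comp x₀ (hes.comp x₀ hpair)).congr_of_eventuallyEq ?_
  filter_upwards [hpair.continuousAt.eventually_mem (e.open_target.mem_nhds ht)] with x hx
  have h1 := e.right_inv hx
  rw [he, Prod.mk.injEq] at h1
  have h2 : e.symm (x, c) = (x, (e.symm (x, c)).2) := Prod.ext h1.1 rfl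
  exact ((hX x _).1 ((congrArg F h2).symm.trans h1.2)).symm

end Flow

/-- For a Tonelli Lagrangian without conjugate points, `T > 0` and
`r ∈ ℤⁿ`, the vector field `X` defined by `X x = c'(0)`, where `c` is the extremal curve
with `c 0 = x` and `c T = x + r`, is well defined (unique), `ℤⁿ`-periodic and `C^{k-1}`. -/
theorem vector_field_regular (n k : ℕ) (hn : 1 ≤ n) (hk : 2 ≤ k)
    (L : E n × E n → ℝ) (hL : IsTonelliLagrangian n (k : ℕ∞) L)
    (φ : ℝ → E n × E n → E n × E n) (hφ : IsELFlow n k L φ)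
    (hnc : NoConjugatePoints n φ)
    (T : ℝ) (hT : 0 < T) (r : Fin n → ℤ) :
    ∃ X : E n → E n,
      (∀ x : E n, (φ T (x, X x)).1 = x + intVec r) ∧
      (∀ x v : E n, (φ T (x, v)).1 = x + intVec r → v = X x) ∧
      (∀ (x : E n) (m : Fin n → ℤ), X (x + intVec m) = X x) ∧
      ContDiff ℝ ((k - 1 : ℕ) : ℕ∞) X := by
  have hinj (x : E n) : Function.Injective fun v => (φ T (x, v)).1 :=
    (hφ.bijective hk hL hnc hT x).1
  choose X hX using fun x => (hφ.bijective hk hL hnc hT x).2 (x + intVec r)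
  have huniq (x v : E n) (h : (φ T (x, v)).1 = x + intVec r) : v = X x :=
    hinj x (h.trans (hX x).symm)
  refine ⟨X, hX, huniq, fun x m => ?_, ?_⟩
  · refine huniq x _ (add_right_cancel (b := intVec m) ?_)
    rw [← hφ.fst_add_intVec hk hL hT.le]
    exact (hX _).trans (add_right_comm _ _ _)
  · have hφT : ContDiff ℝ ((k - 1 : ℕ) : ℕ∞) (φ T) := hφ.1.comp (contDiff_prodMk_right T)
    refine contDiff_of_unique_solution (F := fun z => (φ T z).1 - z.1) (c := intVec r)
      (by exact_mod_cast (by omega : 1 ≤ k - 1)) (hφT.fst.sub contDiff_fst) (fun z u hu => ?_)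
      fun x v => ⟨fun h => huniq x v ?_, fun h => ?_⟩
    · have hd : HasFDerivAt (fun z => (φ T z).1 - z.1) _ z :=
        ((hφ.differentiable hk T z).hasFDerivAt.fst).sub hasFDerivAt_fst
      rw [hd.fderiv] at hu
      exact hnc z T hT.ne' u (by simpa using hu)
    · exact sub_eq_iff_eq_add'.1 h
    · exact sub_eq_iff_eq_add'.2 (h ▸ hX x)

end
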